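/- arXiv:1911.11224 — 5 statements merged into one kernel-verified Lean document; each statement's English description precedes it below -/
import Mathlib

section
/- Let T₁,…,T_N : ℝ³ → Matrix(3,3,ℝ) and f₁,…,f_N : ℝ³ → ℝ³ be continuous. Suppose that for every open ball Ω ⊆ ℝ³, every constant vector c ∈ ℝ³, and every skew-symmetric matrix W ∈ Matrix(3,3,ℝ), one has Σ_{α=1}^N ∫_Ω ( T_α(x)·W + f_α(x)·(c + W x) ) dx = 0 (invariance of the internal power under superposed rigid velocity fields x ↦ c + W x, whose spatial gradient is W). Then Σ_{α=1}^N f_α(x) = 0 for every x, and the total stress Σ_{α=1}^N T_α(x) is a symmetric matrix for every x. -/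
open Matrix MeasureTheory

noncomputable section

/-- The Frobenius inner product `A·B = tr(AᵀB)` of two matrices. -/
def frob (A B : Matrix (Fin 3) (Fin 3) ℝ) : ℝ := (Aᵀ * B).trace

/-- A continuous function that is positive at a point has positive integral over some ball
around it. -/
lemma exists_ball_setIntegral_pos {g : (Fin 3 → ℝ) → ℝ} (hg : Continuous g) {x : Fin 3 → ℝ}
    (hx : 0 < g x) : ∃ r, 0 < r ∧ 0 < ∫ y in Metric.ball x r, g y := by
  obtain ⟨r, hr, hball⟩ := Metric.isOpen_iff.1 (isOpen_lt continuous_const hg) x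
    (show g x / 2 < g x by linarith)
  refine ⟨r, hr, ?_⟩
  have hint : IntegrableOn g (Metric.ball x r) :=
    (hg.continuousOn.integrableOn_compact (isCompact_closedBall x r)).mono_set
      Metric.ball_subset_closedBall
  have hle := setIntegral_ge_of_const_le_real measurableSet_ball
    measure_ball_lt_top.ne (fun y hy => (hball hy).le) hint
  have hvol : 0 < volume.real (Metric.ball x r) :=
    ENNReal.toReal_pos (Metric.measure_ball_pos volume x hr).ne' measure_ball_lt_top.ne
  exact (mul_pos (half_pos hx) hvol).trans_le hle

/-- A continuous function whose integral over every ball vanishes is zero. -/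
lemma eq_zero_of_forall_setIntegral_ball_eq_zero {g : (Fin 3 → ℝ) → ℝ} (hg : Continuous g)
    (h : ∀ x r, 0 < r → ∫ y in Metric.ball x r, g y = 0) (x : Fin 3 → ℝ) : g x = 0 := by
  rcases lt_trichotomy (g x) 0 with hx | hx | hx
  · obtain ⟨r, hr, hpos⟩ := exists_ball_setIntegral_pos hg.neg (neg_pos.2 hx)
    simp [integral_neg, h x r hr] at hpos
  · exact hx
  · obtain ⟨r, hr, hpos⟩ := exists_ball_setIntegral_pos hg hx
    exact absurd (h x r hr) hpos.ne'

lemma frob_eq_sum (A B : Matrix (Fin 3) (Fin 3) ℝ) :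
    frob A B = ∑ j, ∑ i, A i j * B i j := by
  simp [frob, Matrix.trace, Matrix.mul_apply]

lemma frob_sum_left {ι : Type*} (s : Finset ι) (A : ι → Matrix (Fin 3) (Fin 3) ℝ)
    (B : Matrix (Fin 3) (Fin 3) ℝ) : frob (∑ a ∈ s, A a) B = ∑ a ∈ s, frob (A a) B := by
  simp [frob, Matrix.transpose_sum, Finset.sum_mul, Matrix.trace_sum]

lemma isSymm_of_forall_frob_skew_eq_zero {S : Matrix (Fin 3) (Fin 3) ℝ}
    (h : ∀ W : Matrix (Fin 3) (Fin 3) ℝ, Wᵀ = -W → frob S W = 0) : S.IsSymm := by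
  have hskew : frob S (S - Sᵀ) = 0 := h _ (by simp)
  have hskew' : frob (S - Sᵀ) (S - Sᵀ) = 0 := by
    simp only [frob_eq_sum, Fin.sum_univ_three, Matrix.sub_apply, Matrix.transpose_apply]
      at hskew ⊢
    linarith
  have hzero : S - Sᵀ = 0 := Matrix.trace_conjTranspose_mul_self_eq_zero_iff.1 (by
    simpa [frob, Matrix.conjTranspose_eq_transpose_of_trivial] using hskew')
  exact (sub_eq_zero.1 hzero).symm

/-- invariance of the internal power under superposed rigid velocity
fields `x ↦ c + W x` (with `W` skew) forces the internal forces to add up to zero and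
the total stress to be symmetric. -/
theorem internal_power_invariance
    (N : ℕ)
    (T : Fin N → (Fin 3 → ℝ) → Matrix (Fin 3) (Fin 3) ℝ)
    (f : Fin N → (Fin 3 → ℝ) → (Fin 3 → ℝ))
    (hT : ∀ α i j, Continuous (fun x => T α x i j))
    (hf : ∀ α, Continuous (f α))
    (hpow : ∀ (x₀ : Fin 3 → ℝ) (r : ℝ), 0 < r →
      ∀ (c : Fin 3 → ℝ) (W : Matrix (Fin 3) (Fin 3) ℝ), Wᵀ = -W →
        ∑ α, ∫ x in Metric.ball x₀ r,
          (frob (T α x) W + f α x ⬝ᵥ (c + W.mulVec x)) = 0) :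
    ∀ x : Fin 3 → ℝ, (∑ α, f α x) = 0 ∧ (∑ α, T α x).IsSymm := by
  have hcont (α : Fin N) (c : Fin 3 → ℝ) (W : Matrix (Fin 3) (Fin 3) ℝ) :
      Continuous fun x => frob (T α x) W + f α x ⬝ᵥ (c + W.mulVec x) := by
    have hTα := hT α
    have hfα := hf α
    simp only [frob_eq_sum]
    refine Continuous.add (by fun_prop) (hfα.dotProduct ?_)
    exact continuous_const.add (continuous_const.matrix_mulVec continuous_id)
  have hpt (c : Fin 3 → ℝ) (W : Matrix (Fin 3) (Fin 3) ℝ) (hW : Wᵀ = -W) (x : Fin 3 → ℝ) :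
      frob (∑ α, T α x) W + (∑ α, f α x) ⬝ᵥ (c + W.mulVec x) = 0 := by
    rw [frob_sum_left, sum_dotProduct, ← Finset.sum_add_distrib]
    refine eq_zero_of_forall_setIntegral_ball_eq_zero
      (g := fun x => ∑ α, (frob (T α x) W + f α x ⬝ᵥ (c + W.mulVec x)))
      (continuous_finsetSum _ fun α _ => hcont α c W) (fun x₀ r hr => ?_) x
    rw [integral_finsetSum _ fun α _ =>
      ((hcont α c W).continuousOn.integrableOn_compact (isCompact_closedBall x₀ r)).mono_set
        Metric.ball_subset_closedBall]
    exact hpow x₀ r hr c W hW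
  intro x
  have hforce : ∑ α, f α x = 0 := dotProduct_eq_zero _ fun c => by
    simpa [frob] using hpt c 0 (by simp) x
  refine ⟨hforce, isSymm_of_forall_frob_skew_eq_zero fun W hW => ?_⟩
  simpa [hforce] using hpt 0 W hW x
end
end

section
/- Let χ be a motion with spatial velocity v, let P ⊆ U be a compact measurable set, and let ψ : ℝ³ × ℝ → ℝ be a C¹ spatial scalar field. Denote by Ω(t) := χ(P,t) the region convecting with the motion. Then for every t, (d/dt) ∫_{Ω(t)} ψ(x,t) dx = ∫_{Ω(t)} ( ∂ₜψ(x,t) + div(ψ v)(x,t) ) dx (Reynolds transport theorem). -/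
open Matrix MeasureTheory

noncomputable section

/-- The deformation gradient `F(X,t) = D_X χ(X,t)` of a motion, as a matrix. -/
def defGrad (χ : (Fin 3 → ℝ) → ℝ → (Fin 3 → ℝ)) (X : Fin 3 → ℝ) (t : ℝ) :
    Matrix (Fin 3) (Fin 3) ℝ :=
  Matrix.of fun i j => fderiv ℝ (fun Y => χ Y t i) X (Pi.single j 1)

/-- If `v ∘ f` agrees near `a` with a differentiable map and `f` is strictly differentiable with
invertible derivative at `a`, then `v` is differentiable at `f a`. -/
theorem HasStrictFDerivAt.hasFDerivAt_of_comp_eventuallyEq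
    {E F G : Type*} [NormedAddCommGroup E] [NormedSpace ℝ E] [CompleteSpace E]
    [NormedAddCommGroup F] [NormedSpace ℝ F] [NormedAddCommGroup G] [NormedSpace ℝ G]
    {f : E → F} {A : E ≃L[ℝ] F} {a : E} {v : F → G} {w : E → G} {w' : E →L[ℝ] G}
    (hf : HasStrictFDerivAt f (A : E →L[ℝ] F) a) (hw : HasFDerivAt w w' a)
    (hvw : ∀ᶠ x in nhds a, v (f x) = w x) :
    HasFDerivAt v (w'.comp (A.symm : F →L[ℝ] E)) (f a) := by
  have hg := hf.to_localInverse.hasFDerivAt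
  have hw' : HasFDerivAt w w' (hf.localInverse f A a (f a)) := by
    rwa [hf.localInverse_apply_image]
  refine (hw'.comp (f a) hg).congr_of_eventuallyEq ?_
  filter_upwards [hf.eventually_right_inverse, hf.localInverse_tendsto.eventually hvw]
    with y hy hvy
  rw [Function.comp_apply, ← hvy, hy]

/-- Jacobi's formula for a matrix curve with `M' = B M`. -/
theorem hasDerivAt_det_fin_three {M : ℝ → Matrix (Fin 3) (Fin 3) ℝ}
    {B : Matrix (Fin 3) (Fin 3) ℝ} {t : ℝ}
    (h : ∀ i j, HasDerivAt (fun s => M s i j) ((B * M t) i j) t) :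
    HasDerivAt (fun s => (M s).det) (B.trace * (M t).det) t := by
  simp only [det_fin_three]
  refine ((((((((h 0 0).mul (h 1 1)).mul (h 2 2)).sub
    (((h 0 0).mul (h 1 2)).mul (h 2 1))).sub
    (((h 0 1).mul (h 1 0)).mul (h 2 2))).add
    (((h 0 1).mul (h 1 2)).mul (h 2 0))).add
    (((h 0 2).mul (h 1 0)).mul (h 2 1))).sub
    (((h 0 2).mul (h 1 1)).mul (h 2 0))).congr_deriv ?_
  simp only [Matrix.mul_apply, Fin.sum_univ_three, Matrix.trace, Matrix.diag_apply, Pi.mul_apply]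
  ring

/-- Differentiation under the integral sign over a compact set, for a `C¹` integrand. -/
theorem hasDerivAt_setIntegral_of_contDiffOn
    {E : Type*} [NormedAddCommGroup E] [NormedSpace ℝ E] [MeasurableSpace E] [BorelSpace E]
    [SecondCountableTopology E] {μ : Measure E} [IsFiniteMeasureOnCompacts μ]
    {U P : Set E} (hU : IsOpen U) (hPc : IsCompact P) (hPU : P ⊆ U) {G : E × ℝ → ℝ}
    (hG : ContDiffOn ℝ 1 G (U ×ˢ Set.univ)) (t : ℝ) :
    HasDerivAt (fun s => ∫ x in P, G (x, s) ∂μ) (∫ x in P, fderiv ℝ G (x, t) (0, 1) ∂μ) t := by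
  have hS : IsOpen (U ×ˢ (Set.univ : Set ℝ)) := hU.prod isOpen_univ
  have hmem : ∀ x ∈ P, ∀ s : ℝ, (x, s) ∈ U ×ˢ (Set.univ : Set ℝ) :=
    fun x hx s => ⟨hPU hx, Set.mem_univ s⟩
  have hG' : ContinuousOn (fun p => fderiv ℝ G p (0, 1)) (U ×ˢ Set.univ) :=
    (hG.continuousOn_fderiv_of_isOpen hS le_rfl).clm_apply continuousOn_const
  have hslice : ∀ {H : E × ℝ → ℝ}, ContinuousOn H (U ×ˢ Set.univ) → ∀ s : ℝ,
      ContinuousOn (fun x => H (x, s)) P := fun hH s =>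
    hH.comp (by fun_prop) fun x hx => hmem x hx s
  have hPm : MeasurableSet P := hPc.measurableSet
  obtain ⟨C, hC⟩ :=
    (hPc.prod (isCompact_Icc (a := t - 1) (b := t + 1))).exists_bound_of_continuousOn
    (hG'.mono fun p hp => hmem p.1 hp.1 p.2)
  refine (hasDerivAt_integral_of_dominated_loc_of_deriv_le (μ := μ.restrict P)
    (F := fun s x => G (x, s)) (F' := fun s x => fderiv ℝ G (x, s) (0, 1))
    (bound := fun _ => C) (Icc_mem_nhds (by linarith : t - 1 < t) (by linarith : t < t + 1))
    (.of_forall fun s => (hslice hG.continuousOn s).aestronglyMeasurable_of_isCompact hPc hPm)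
    ((hslice hG.continuousOn t).integrableOn_compact hPc)
    ((hslice hG' t).aestronglyMeasurable_of_isCompact hPc hPm) ?_ ?_ ?_).2
  · filter_upwards [ae_restrict_mem hPm] with x hx s hs using hC (x, s) ⟨hx, hs⟩
  · exact continuousOn_const.integrableOn_compact hPc
  · filter_upwards [ae_restrict_mem hPm] with x hx s _
    have hd : HasFDerivAt G (fderiv ℝ G (x, s)) (x, s) :=
      ((hG.contDiffAt (hS.mem_nhds (hmem x hx s))).differentiableAt one_ne_zero).hasFDerivAt
    exact hd.comp_hasDerivAt s ((hasDerivAt_const s x).prodMk (hasDerivAt_id s))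

section Motion

variable {U : Set (Fin 3 → ℝ)} {χ : (Fin 3 → ℝ) → ℝ → (Fin 3 → ℝ)}
  {v : (Fin 3 → ℝ) → ℝ → (Fin 3 → ℝ)} {X : Fin 3 → ℝ} {t : ℝ}

/-- The spatial derivative of a motion as a continuous linear map. -/
def spatialDeriv (χ : (Fin 3 → ℝ) → ℝ → (Fin 3 → ℝ)) (X : Fin 3 → ℝ) (t : ℝ) :
    (Fin 3 → ℝ) →L[ℝ] (Fin 3 → ℝ) :=
  (fderiv ℝ (fun p : (Fin 3 → ℝ) × ℝ => χ p.1 p.2) (X, t)).comp (.inl ℝ (Fin 3 → ℝ) ℝ)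

theorem hasStrictFDerivAt_spatialDeriv
    (hχ : ContDiffAt ℝ 2 (fun p : (Fin 3 → ℝ) × ℝ => χ p.1 p.2) (X, t)) :
    HasStrictFDerivAt (fun Y => χ Y t) (spatialDeriv χ X t) X :=
  HasStrictFDerivAt.comp (f := fun Y => (Y, t)) X (hχ.hasStrictFDerivAt two_ne_zero)
    ((hasStrictFDerivAt_id X).prodMk (hasStrictFDerivAt_const t X))

theorem defGrad_apply
    (hχ : ContDiffAt ℝ 2 (fun p : (Fin 3 → ℝ) × ℝ => χ p.1 p.2) (X, t)) (i j : Fin 3) :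
    defGrad χ X t i j =
      fderiv ℝ (fun p : (Fin 3 → ℝ) × ℝ => χ p.1 p.2) (X, t) (Pi.single j 1, 0) i := by
  have h := hasFDerivAt_pi'.1 (hasStrictFDerivAt_spatialDeriv hχ).hasFDerivAt i
  simp only [defGrad, Matrix.of_apply, h.fderiv]
  rfl

theorem defGrad_eq_toMatrix'
    (hχ : ContDiffAt ℝ 2 (fun p : (Fin 3 → ℝ) × ℝ => χ p.1 p.2) (X, t)) :
    defGrad χ X t = LinearMap.toMatrix' (spatialDeriv χ X t : (Fin 3 → ℝ) →ₗ[ℝ] (Fin 3 → ℝ)) := by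
  ext i j
  rw [defGrad_apply hχ, LinearMap.toMatrix'_apply]
  rfl

theorem det_spatialDeriv
    (hχ : ContDiffAt ℝ 2 (fun p : (Fin 3 → ℝ) × ℝ => χ p.1 p.2) (X, t)) :
    (spatialDeriv χ X t).det = (defGrad χ X t).det := by
  rw [defGrad_eq_toMatrix' hχ, LinearMap.det_toMatrix', ContinuousLinearMap.det]

theorem contDiffOn_det_defGrad (hU : IsOpen U)
    (hχ : ContDiffOn ℝ 2 (fun p : (Fin 3 → ℝ) × ℝ => χ p.1 p.2) (U ×ˢ Set.univ)) :
    ContDiffOn ℝ 1 (fun p : (Fin 3 → ℝ) × ℝ => (defGrad χ p.1 p.2).det) (U ×ˢ Set.univ) := by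
  have hS : IsOpen (U ×ˢ (Set.univ : Set ℝ)) := hU.prod isOpen_univ
  have hD := hχ.fderiv_of_isOpen (m := 1) hS (by norm_num)
  have h : ∀ i j, ContDiffOn ℝ 1 (fun p : (Fin 3 → ℝ) × ℝ => defGrad χ p.1 p.2 i j)
      (U ×ˢ Set.univ) := fun i j =>
    (contDiffOn_pi.1 (hD.clm_apply (contDiffOn_const (c := (Pi.single j 1, 0)))) i).congr
      fun p hp => defGrad_apply (hχ.contDiffAt (hS.mem_nhds hp)) i j
  simp only [det_fin_three]
  exact ((((((((h 0 0).mul (h 1 1)).mul (h 2 2)).sub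
    (((h 0 0).mul (h 1 2)).mul (h 2 1))).sub
    (((h 0 1).mul (h 1 0)).mul (h 2 2))).add
    (((h 0 1).mul (h 1 2)).mul (h 2 0))).add
    (((h 0 2).mul (h 1 0)).mul (h 2 1))).sub
    (((h 0 2).mul (h 1 1)).mul (h 2 0)))

theorem hasDerivAt_motion
    (hχ : ContDiffAt ℝ 2 (fun p : (Fin 3 → ℝ) × ℝ => χ p.1 p.2) (X, t)) :
    HasDerivAt (fun τ => χ X τ)
      (fderiv ℝ (fun p : (Fin 3 → ℝ) × ℝ => χ p.1 p.2) (X, t) (0, 1)) t :=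
  (hχ.differentiableAt two_ne_zero).hasFDerivAt.comp_hasDerivAt t
    ((hasDerivAt_const t X).prodMk (hasDerivAt_id t))

/-- The spatial velocity is differentiable along the trajectory, and its gradient `B` satisfies
`B F = D_X ∂ₜχ`. -/
theorem exists_hasFDerivAt_velocity (hU : IsOpen U)
    (hχ : ContDiffOn ℝ 2 (fun p : (Fin 3 → ℝ) × ℝ => χ p.1 p.2) (U ×ˢ Set.univ))
    (hF : (defGrad χ X t).det ≠ 0)
    (hveq : ∀ Y ∈ U, v (χ Y t) t = deriv (fun τ => χ Y τ) t) (hX : X ∈ U) :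
    ∃ B : (Fin 3 → ℝ) →L[ℝ] (Fin 3 → ℝ), HasFDerivAt (fun y => v y t) B (χ X t) ∧
      ∀ h, B (spatialDeriv χ X t h) =
        fderiv ℝ (fderiv ℝ (fun p : (Fin 3 → ℝ) × ℝ => χ p.1 p.2)) (X, t) (h, 0) (0, 1) := by
  have hS : IsOpen (U ×ˢ (Set.univ : Set ℝ)) := hU.prod isOpen_univ
  have hat : ∀ Y ∈ U, ContDiffAt ℝ 2 (fun p : (Fin 3 → ℝ) × ℝ => χ p.1 p.2) (Y, t) :=
    fun Y hY => hχ.contDiffAt (hS.mem_nhds ⟨hY, Set.mem_univ t⟩)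
  have hdet : (spatialDeriv χ X t).det ≠ 0 := by rwa [det_spatialDeriv (hat X hX)]
  set A := (spatialDeriv χ X t).toContinuousLinearEquivOfDetNeZero hdet with hA
  have hf : HasStrictFDerivAt (fun Y => χ Y t) (A : (Fin 3 → ℝ) →L[ℝ] (Fin 3 → ℝ)) X := by
    rw [hA, ContinuousLinearMap.coe_toContinuousLinearEquivOfDetNeZero]
    exact hasStrictFDerivAt_spatialDeriv (hat X hX)
  have hD2 : HasFDerivAt (fderiv ℝ (fun p : (Fin 3 → ℝ) × ℝ => χ p.1 p.2))
      (fderiv ℝ (fderiv ℝ (fun p : (Fin 3 → ℝ) × ℝ => χ p.1 p.2)) (X, t)) (X, t) :=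
    (((hat X hX).fderiv_right (m := 1) (by norm_num)).differentiableAt one_ne_zero).hasFDerivAt
  have hw := (HasFDerivAt.comp (f := fun Y => (Y, t)) X hD2 (hasFDerivAt_prodMk_left X t)).clm_apply
    (hasFDerivAt_const ((0, 1) : (Fin 3 → ℝ) × ℝ) X)
  refine ⟨_, hf.hasFDerivAt_of_comp_eventuallyEq (v := fun y => v y t) hw ?_, fun h => ?_⟩
  · filter_upwards [hU.mem_nhds hX] with Y hY
    rw [hveq Y hY, (hasDerivAt_motion (hat Y hY)).deriv]
    rfl
  · have : A.symm (spatialDeriv χ X t h) = h := A.symm_apply_apply h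
    simp [this]

/-- Euler's expansion formula: `∂ₜ det F = (div v) det F`. -/
theorem hasDerivAt_det_defGrad (hU : IsOpen U)
    (hχ : ContDiffOn ℝ 2 (fun p : (Fin 3 → ℝ) × ℝ => χ p.1 p.2) (U ×ˢ Set.univ)) (hX : X ∈ U)
    {B : (Fin 3 → ℝ) →L[ℝ] (Fin 3 → ℝ)}
    (hB : ∀ h, B (spatialDeriv χ X t h) =
        fderiv ℝ (fderiv ℝ (fun p : (Fin 3 → ℝ) × ℝ => χ p.1 p.2)) (X, t) (h, 0) (0, 1)) :
    HasDerivAt (fun s => (defGrad χ X s).det)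
      ((∑ i, B (Pi.single i 1) i) * (defGrad χ X t).det) t := by
  have hS : IsOpen (U ×ˢ (Set.univ : Set ℝ)) := hU.prod isOpen_univ
  have hat : ∀ s, ContDiffAt ℝ 2 (fun p : (Fin 3 → ℝ) × ℝ => χ p.1 p.2) (X, s) :=
    fun s => hχ.contDiffAt (hS.mem_nhds ⟨hX, Set.mem_univ s⟩)
  have hD2 : HasFDerivAt (fderiv ℝ (fun p : (Fin 3 → ℝ) × ℝ => χ p.1 p.2))
      (fderiv ℝ (fderiv ℝ (fun p : (Fin 3 → ℝ) × ℝ => χ p.1 p.2)) (X, t)) (X, t) :=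
    (((hat t).fderiv_right (m := 1) (by norm_num)).differentiableAt one_ne_zero).hasFDerivAt
  have htrace : (∑ i, B (Pi.single i 1) i) =
      (LinearMap.toMatrix' (B : (Fin 3 → ℝ) →ₗ[ℝ] (Fin 3 → ℝ))).trace := by
    simp [Matrix.trace, LinearMap.toMatrix'_apply]
  rw [htrace]
  refine hasDerivAt_det_fin_three fun i j => ?_
  simp only [fun s => defGrad_apply (hat s) i j]
  have h1 := hD2.comp_hasDerivAt t ((hasDerivAt_const t X).prodMk (hasDerivAt_id t))
  have h2 := hasDerivAt_pi.1 (h1.clm_apply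
    (hasDerivAt_const t ((Pi.single j 1, 0) : (Fin 3 → ℝ) × ℝ))) i
  refine h2.congr_deriv ?_
  rw [defGrad_eq_toMatrix' (hat t), ← LinearMap.toMatrix'_comp, LinearMap.toMatrix'_apply]
  have hsymm := (hat t).isSymmSndFDerivAt (by simp) (0, 1) (Pi.single j 1, 0)
  simp [hB, hsymm]

end Motion

/-- Reynolds transport theorem: for a region `Ω(t) = χ(P,t)` convecting
with the motion and a C¹ spatial scalar field `ψ`,
`(d/dt) ∫_{Ω(t)} ψ = ∫_{Ω(t)} (∂ₜψ + div(ψ v))`. -/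
theorem reynolds_transport
    (U : Set (Fin 3 → ℝ)) (hU : IsOpen U)
    (χ : (Fin 3 → ℝ) → ℝ → (Fin 3 → ℝ))
    (hχ : ContDiffOn ℝ 2 (fun p : (Fin 3 → ℝ) × ℝ => χ p.1 p.2) (U ×ˢ Set.univ))
    (hinj : ∀ t : ℝ, Set.InjOn (fun X => χ X t) U)
    (hopen : ∀ t : ℝ, IsOpen ((fun X => χ X t) '' U))
    (hF : ∀ X ∈ U, ∀ t : ℝ, 0 < (defGrad χ X t).det)
    (v : (Fin 3 → ℝ) → ℝ → (Fin 3 → ℝ))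
    (hveq : ∀ X ∈ U, ∀ t : ℝ, v (χ X t) t = deriv (fun τ => χ X τ) t)
    (P : Set (Fin 3 → ℝ)) (hPc : IsCompact P) (hPm : MeasurableSet P) (hPU : P ⊆ U)
    (ψ : (Fin 3 → ℝ) → ℝ → ℝ)
    (hψ : ContDiff ℝ 1 (fun p : (Fin 3 → ℝ) × ℝ => ψ p.1 p.2)) :
    ∀ t : ℝ,
      HasDerivAt (fun τ => ∫ x in (fun X => χ X τ) '' P, ψ x τ)
        (∫ x in (fun X => χ X t) '' P,
          (deriv (fun τ => ψ x τ) t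
            + ∑ i, fderiv ℝ (fun y => ψ y t * v y t i) x (Pi.single i 1))) t := by
  intro t
  have hS : IsOpen (U ×ˢ (Set.univ : Set ℝ)) := hU.prod isOpen_univ
  have hat : ∀ X ∈ U, ∀ s, ContDiffAt ℝ 2 (fun p : (Fin 3 → ℝ) × ℝ => χ p.1 p.2) (X, s) :=
    fun X hX s => hχ.contDiffAt (hS.mem_nhds ⟨hX, Set.mem_univ s⟩)
  have hchange : ∀ (g : (Fin 3 → ℝ) → ℝ) (s : ℝ),
      ∫ x in (fun X => χ X s) '' P, g x = ∫ X in P, (defGrad χ X s).det * g (χ X s) := by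
    intro g s
    rw [integral_image_eq_integral_abs_det_fderiv_smul volume hPm
      (fun X hX => (hasStrictFDerivAt_spatialDeriv
        (hat X (hPU hX) s)).hasFDerivAt.hasFDerivWithinAt) ((hinj s).mono hPU)]
    refine setIntegral_congr_fun hPm fun X hX => ?_
    simp only [det_spatialDeriv (hat X (hPU hX) s), abs_of_pos (hF X (hPU hX) s), smul_eq_mul]
  have hG : ContDiffOn ℝ 1 (fun p : (Fin 3 → ℝ) × ℝ =>
      (defGrad χ p.1 p.2).det * ψ (χ p.1 p.2) p.2) (U ×ˢ Set.univ) :=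
    (contDiffOn_det_defGrad hU hχ).mul
      (hψ.comp_contDiffOn ((hχ.of_le (by norm_num)).prodMk contDiffOn_snd))
  simp only [hchange]
  refine (hasDerivAt_setIntegral_of_contDiffOn hU hPc hPU hG t).congr_deriv ?_
  refine setIntegral_congr_fun hPm fun X hXP => ?_
  have hX := hPU hXP
  obtain ⟨B, hvB, hB⟩ := exists_hasFDerivAt_velocity hU hχ (hF X hX t).ne'
    (fun Y hY => hveq Y hY t) hX
  have hψd : HasFDerivAt (fun p : (Fin 3 → ℝ) × ℝ => ψ p.1 p.2)
      (fderiv ℝ (fun p : (Fin 3 → ℝ) × ℝ => ψ p.1 p.2) (χ X t, t)) (χ X t, t) :=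
    (hψ.differentiable one_ne_zero _).hasFDerivAt
  set L := fderiv ℝ (fun p : (Fin 3 → ℝ) × ℝ => ψ p.1 p.2) (χ X t, t)
  have hvel : HasDerivAt (fun τ => χ X τ) (v (χ X t) t) t := by
    rw [hveq X hX t]
    exact (hasDerivAt_motion (hat X hX t)).differentiableAt.hasDerivAt
  have hψt : HasDerivAt (fun τ => ψ (χ X t) τ) (L (0, 1)) t :=
    hψd.comp_hasDerivAt t ((hasDerivAt_const t (χ X t)).prodMk (hasDerivAt_id t))
  have hψx : HasFDerivAt (fun y => ψ y t) (L.comp (.inl ℝ (Fin 3 → ℝ) ℝ)) (χ X t) :=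
    HasFDerivAt.comp (f := fun y => (y, t)) (χ X t) hψd (hasFDerivAt_prodMk_left (χ X t) t)
  have hψc : HasDerivAt (fun τ => ψ (χ X τ) τ) (L (v (χ X t) t, 1)) t :=
    HasFDerivAt.comp_hasDerivAt (f := fun τ => (χ X τ, τ)) t hψd (hvel.prodMk (hasDerivAt_id t))
  have hXt : (X, t) ∈ U ×ˢ (Set.univ : Set ℝ) := ⟨hX, Set.mem_univ t⟩
  have hGt := ((hG.contDiffAt (hS.mem_nhds hXt)).differentiableAt
    one_ne_zero).hasFDerivAt.comp_hasDerivAt t ((hasDerivAt_const t X).prodMk (hasDerivAt_id t))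
  have hdiv : ∀ i, fderiv ℝ (fun y => ψ y t * v y t i) (χ X t) (Pi.single i 1) =
      ψ (χ X t) t * B (Pi.single i 1) i + v (χ X t) t i * L (Pi.single i 1, 0) := by
    intro i
    have h := (hψx.mul (hasFDerivAt_pi'.1 hvB i)).fderiv
    simp only [Pi.mul_def] at h
    rw [h]
    simp
  have hLv : L (v (χ X t) t, 1) = (∑ i, v (χ X t) t i * L (Pi.single i 1, 0)) + L (0, 1) := by
    have h1 : (v (χ X t) t, (1 : ℝ)) = (v (χ X t) t, 0) + (0, 1) := by simp
    rw [h1, map_add]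
    congr 1
    have h2 := (L.comp (.inl ℝ (Fin 3 → ℝ) ℝ)).toLinearMap.pi_apply_eq_sum_univ (v (χ X t) t)
    have h3 : ∀ i : Fin 3, (fun j => if i = j then (1 : ℝ) else 0) = Pi.single i 1 := by
      intro i
      ext j
      simp [Pi.single_apply, eq_comm]
    simpa [h3] using h2
  have huniq := hGt.unique ((hasDerivAt_det_defGrad hU hχ hX hB).mul hψc)
  simp only [huniq, hψt.deriv, hdiv, hLv, Finset.sum_add_distrib, ← Finset.mul_sum]
  ring
end
end

section
/- Let T_s, T_f : ℝ³ → Matrix(3,3,ℝ) with T_f C¹, let f_f : ℝ³ → ℝ³ satisfy div T_f = f_f, suppose T_f = −φ_f λ I for C¹ scalar fields φ_f, λ, set T := T_s + T_f, and let v_s, v_f : ℝ³ → ℝ³ be C¹ vector fields. Then, pointwise, T_s·∇v_s + T_f·∇v_f + f_f·(v_f − v_s) = T·∇v_s − div( λ φ_f (v_f − v_s) ). -/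
open Matrix

noncomputable section

/-- The spatial gradient (Jacobian matrix) of a vector field. -/
def gradv (u : (Fin 3 → ℝ) → (Fin 3 → ℝ)) (x : Fin 3 → ℝ) : Matrix (Fin 3) (Fin 3) ℝ :=
  Matrix.of fun i j => fderiv ℝ (fun y => u y i) x (Pi.single j 1)

/-- Product rule for the directional derivative of `p (a - b)`. -/
theorem fderiv_mul_sub_apply {E : Type*} [NormedAddCommGroup E] [NormedSpace ℝ E]
    {p a b : E → ℝ} {x : E} (hp : DifferentiableAt ℝ p x)
    (ha : DifferentiableAt ℝ a x) (hb : DifferentiableAt ℝ b x) (e : E) :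
    fderiv ℝ (fun y => p y * (a y - b y)) x e
      = p x * (fderiv ℝ a x e - fderiv ℝ b x e) + (a x - b x) * fderiv ℝ p x e := by
  rw [(hp.hasFDerivAt.fun_mul (ha.hasFDerivAt.fun_sub hb.hasFDerivAt)).fderiv]
  simp

theorem frob_add_left (A B C : Matrix (Fin 3) (Fin 3) ℝ) :
    frob (A + B) C = frob A C + frob B C := by
  simp [frob, Matrix.add_mul]

theorem frob_smul_one_left (c : ℝ) (A : Matrix (Fin 3) (Fin 3) ℝ) :
    frob (c • (1 : Matrix (Fin 3) (Fin 3) ℝ)) A = c * A.trace := by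
  simp [frob]

/-- the pointwise identity
`T_s·∇v_s + T_f·∇v_f + f_f·(v_f − v_s) = T·∇v_s − div(λ φ_f (v_f − v_s))`
underlying the equivalence of the mixture-theoretic and Biot-type dissipation
inequalities (with `T = T_s + T_f`, `div T_f = f_f`, `T_f = −φ_f λ I`). -/
theorem power_identity_two_constituents
    (Ts Tf : (Fin 3 → ℝ) → Matrix (Fin 3) (Fin 3) ℝ)
    (hTf : ∀ i j, ContDiff ℝ 1 (fun x => Tf x i j))
    (ff : (Fin 3 → ℝ) → (Fin 3 → ℝ))
    (hdivTf : ∀ (x : Fin 3 → ℝ) (i : Fin 3),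
      ∑ j, fderiv ℝ (fun y => Tf y i j) x (Pi.single j 1) = ff x i)
    (φf lam : (Fin 3 → ℝ) → ℝ)
    (hφf : ContDiff ℝ 1 φf) (hlam : ContDiff ℝ 1 lam)
    (hTfval : ∀ x, Tf x = (-(φf x * lam x)) • (1 : Matrix (Fin 3) (Fin 3) ℝ))
    (vs vf : (Fin 3 → ℝ) → (Fin 3 → ℝ))
    (hvs : ContDiff ℝ 1 vs) (hvf : ContDiff ℝ 1 vf) :
    ∀ x : Fin 3 → ℝ,
      frob (Ts x) (gradv vs x) + frob (Tf x) (gradv vf x) + ff x ⬝ᵥ (vf x - vs x)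
      = frob (Ts x + Tf x) (gradv vs x)
        - ∑ i, fderiv ℝ (fun y => lam y * φf y * (vf y i - vs y i)) x (Pi.single i 1) := by
  intro x
  have hp : DifferentiableAt ℝ (fun y => lam y * φf y) x :=
    (hlam.differentiable one_ne_zero x).mul (hφf.differentiable one_ne_zero x)
  have hs : ∀ i, DifferentiableAt ℝ (fun y => vs y i) x :=
    differentiableAt_pi.1 (hvs.differentiable one_ne_zero x)
  have hf : ∀ i, DifferentiableAt ℝ (fun y => vf y i) x :=
    differentiableAt_pi.1 (hvf.differentiable one_ne_zero x)
  have hff : ∀ i, ff x i = -fderiv ℝ (fun y => lam y * φf y) x (Pi.single i 1) := by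
    intro i
    rw [← hdivTf x i, Finset.sum_eq_single i]
    · have h : (fun y => Tf y i i) = fun y => -(lam y * φf y) := by
        funext y
        simp [hTfval, mul_comm]
      rw [h, fderiv_fun_neg]
      rfl
    · intro j _ hj
      have h : (fun y => Tf y i j) = fun _ => (0 : ℝ) := by
        funext y
        simp [hTfval, Matrix.one_apply_ne hj.symm]
      simp [h]
    · simp
  simp only [fderiv_mul_sub_apply hp (hf _) (hs _)]
  rw [frob_add_left, hTfval, frob_smul_one_left, frob_smul_one_left]
  simp only [Matrix.trace, Matrix.diag_apply, gradv, Matrix.of_apply, dotProduct, hff,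
    Pi.sub_apply, Fin.sum_univ_three]
  ring
end
end

section
/- Let U ⊆ ℝ³ be open, let χ : U → ℝ³ be a C² diffeomorphism onto its image with F := Dχ invertible and J := det F, and let a : χ(U) → ℝ³ be a C¹ vector field. Then the Piola identity holds: Div( J F⁻¹ (a ∘ χ) )(X) = J(X) · (div a)(χ(X)) for every X ∈ U, where Div is the divergence with respect to X and div the divergence with respect to the spatial variable. -/
open Matrix

noncomputable section

/-- The deformation gradient `F(X) = Dχ(X)` of a (time-independent) deformation. -/
def defGradS (χ : (Fin 3 → ℝ) → (Fin 3 → ℝ)) (X : Fin 3 → ℝ) :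
    Matrix (Fin 3) (Fin 3) ℝ :=
  Matrix.of fun i j => fderiv ℝ (fun Y => χ Y i) X (Pi.single j 1)

theorem contDiffAt_apply_of_contDiffOn {U : Set (Fin 3 → ℝ)} (hU : IsOpen U)
    {χ : (Fin 3 → ℝ) → (Fin 3 → ℝ)} (hχ : ContDiffOn ℝ 2 χ U) {X : Fin 3 → ℝ} (hX : X ∈ U)
    (i : Fin 3) : ContDiffAt ℝ 2 (fun Y => χ Y i) X :=
  contDiffAt_pi.1 (hχ.contDiffAt (hU.mem_nhds hX)) i

theorem hasFDerivAt_defGradS_apply {χ : (Fin 3 → ℝ) → (Fin 3 → ℝ)} {X : Fin 3 → ℝ} {i : Fin 3}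
    (hχ : ContDiffAt ℝ 2 (fun Y => χ Y i) X) (j : Fin 3) :
    HasFDerivAt (fun Y => defGradS χ Y i j)
      ((fderiv ℝ (fderiv ℝ fun Y => χ Y i) X).flip (Pi.single j 1)) X := by
  have h : DifferentiableAt ℝ (fderiv ℝ fun Y => χ Y i) X :=
    (hχ.fderiv_right (m := 1) (by norm_num)).differentiableAt (by norm_num)
  simpa [defGradS] using h.hasFDerivAt.clm_apply (hasFDerivAt_const (Pi.single j 1) X)

/-- The matrix of second derivatives is symmetric: `∂F_ij/∂X_k = ∂F_ik/∂X_j`. -/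
theorem fderiv_defGradS_apply_comm {χ : (Fin 3 → ℝ) → (Fin 3 → ℝ)} {X : Fin 3 → ℝ} {i : Fin 3}
    (hχ : ContDiffAt ℝ 2 (fun Y => χ Y i) X) (j k : Fin 3) :
    fderiv ℝ (fun Y => defGradS χ Y i j) X (Pi.single k 1) =
      fderiv ℝ (fun Y => defGradS χ Y i k) X (Pi.single j 1) := by
  rw [(hasFDerivAt_defGradS_apply hχ j).fderiv, (hasFDerivAt_defGradS_apply hχ k).fderiv]
  exact hχ.isSymmSndFDerivAt (by simp) _ _

theorem differentiableAt_adjugate_apply {f : (Fin 3 → ℝ) → Matrix (Fin 3) (Fin 3) ℝ}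
    {X : Fin 3 → ℝ} (hf : ∀ i j, DifferentiableAt ℝ (fun Y => f Y i j) X) (i j : Fin 3) :
    DifferentiableAt ℝ (fun Y => (f Y).adjugate i j) X := by
  simp only [adjugate_fin_three]
  fin_cases i <;> fin_cases j <;> simp <;> fun_prop

/-- The columns of the adjugate of a matrix field with curl-free rows are divergence free. -/
theorem sum_fderiv_adjugate_eq_zero {f : (Fin 3 → ℝ) → Matrix (Fin 3) (Fin 3) ℝ}
    {X : Fin 3 → ℝ} (hf : ∀ i j, DifferentiableAt ℝ (fun Y => f Y i j) X)
    (hcurl : ∀ i j k, fderiv ℝ (fun Y => f Y i j) X (Pi.single k 1) =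
      fderiv ℝ (fun Y => f Y i k) X (Pi.single j 1)) (j : Fin 3) :
    ∑ i, fderiv ℝ (fun Y => (f Y).adjugate i j) X (Pi.single i 1) = 0 := by
  have key (p q r s : (Fin 3 → ℝ) → ℝ) (hp : DifferentiableAt ℝ p X)
      (hq : DifferentiableAt ℝ q X) (hr : DifferentiableAt ℝ r X)
      (hs : DifferentiableAt ℝ s X) (v : Fin 3 → ℝ) :
      fderiv ℝ (fun Y => p Y * q Y - r Y * s Y) X v =
        p X * fderiv ℝ q X v + q X * fderiv ℝ p X v
          - (r X * fderiv ℝ s X v + s X * fderiv ℝ r X v) := by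
    rw [((hp.hasFDerivAt.fun_mul hq.hasFDerivAt).fun_sub (hr.hasFDerivAt.fun_mul hs.hasFDerivAt)).fderiv]
    simp
  simp only [adjugate_fin_three, Fin.sum_univ_three]
  fin_cases j <;>
  · simp only [Fin.mk_one, Fin.zero_eta, Fin.reduceFinMk, of_apply, cons_val, neg_add_eq_sub]
    rw [key _ _ _ _ (hf _ _) (hf _ _) (hf _ _) (hf _ _),
      key _ _ _ _ (hf _ _) (hf _ _) (hf _ _) (hf _ _),
      key _ _ _ _ (hf _ _) (hf _ _) (hf _ _) (hf _ _)]
    simp only [hcurl _ 1 0, hcurl _ 2 0, hcurl _ 2 1]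
    ring

theorem det_mul_inv_mulVec_apply {n K : Type*} [Fintype n] [DecidableEq n] [Field K]
    {A : Matrix n n K} (hA : A.det ≠ 0) (v : n → K) (i : n) :
    A.det * (A⁻¹ *ᵥ v) i = ∑ j, A.adjugate i j * v j := by
  rw [inv_def, smul_mulVec, Pi.smul_apply, smul_eq_mul, Ring.inverse_eq_inv', ← mul_assoc,
    mul_inv_cancel₀ hA, one_mul]
  rfl

theorem fderiv_comp_apply_single {χ a : (Fin 3 → ℝ) → (Fin 3 → ℝ)} {X : Fin 3 → ℝ} {j : Fin 3}
    (hχ : DifferentiableAt ℝ χ X) (ha : DifferentiableAt ℝ (fun y => a y j) (χ X)) (k : Fin 3) :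
    fderiv ℝ (fun Y => a (χ Y) j) X (Pi.single k 1) =
      ∑ m, fderiv ℝ (fun y => a y j) (χ X) (Pi.single m 1) * defGradS χ X m k := by
  have h := (ha.hasFDerivAt.comp X hχ.hasFDerivAt).fderiv
  simp only [Function.comp_def] at h
  rw [h, ContinuousLinearMap.comp_apply]
  conv_lhs => rw [pi_eq_sum_univ' (fderiv ℝ χ X (Pi.single k 1)), map_sum]
  refine Finset.sum_congr rfl fun m _ => ?_
  rw [map_smul, smul_eq_mul, mul_comm, defGradS, of_apply, fderiv_apply hχ]
  congr 2

/-- Piola identity: `Div(J F⁻¹ (a∘χ))(X) = J(X) · (div a)(χ(X))` for a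
C² diffeomorphism `χ` with `F = Dχ` invertible, `J = det F`, and a C¹ spatial field `a`. -/
theorem piola_identity
    (U : Set (Fin 3 → ℝ)) (hU : IsOpen U)
    (χ : (Fin 3 → ℝ) → (Fin 3 → ℝ))
    (hχ : ContDiffOn ℝ 2 χ U)
    (hinj : Set.InjOn χ U)
    (hopen : IsOpen (χ '' U))
    (hdet : ∀ X ∈ U, (defGradS χ X).det ≠ 0)
    (a : (Fin 3 → ℝ) → (Fin 3 → ℝ))
    (ha : ContDiffOn ℝ 1 a (χ '' U)) :
    ∀ X ∈ U,
      ∑ i, fderiv ℝ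
          (fun Y => (defGradS χ Y).det * ((defGradS χ Y)⁻¹.mulVec (a (χ Y))) i)
          X (Pi.single i 1)
      = (defGradS χ X).det * ∑ i, fderiv ℝ (fun y => a y i) (χ X) (Pi.single i 1) := by
  intro X hX
  have hχi (i : Fin 3) := contDiffAt_apply_of_contDiffOn hU hχ hX i
  have hF (i j : Fin 3) := (hasFDerivAt_defGradS_apply (hχi i) j).differentiableAt
  have hχX : DifferentiableAt ℝ χ X :=
    (hχ.contDiffAt (hU.mem_nhds hX)).differentiableAt (by norm_num)
  have haX (j : Fin 3) : DifferentiableAt ℝ (fun y => a y j) (χ X) :=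
    differentiableAt_pi.1 ((ha.contDiffAt
      (hopen.mem_nhds (Set.mem_image_of_mem χ hX))).differentiableAt (by norm_num)) j
  have haχ (j : Fin 3) : DifferentiableAt ℝ (fun Y => a (χ Y) j) X := (haX j).comp X hχX
  have hadj (i j : Fin 3) := differentiableAt_adjugate_apply hF i j
  have hprod (i : Fin 3) :
      fderiv ℝ (fun Y => (defGradS χ Y).det * ((defGradS χ Y)⁻¹.mulVec (a (χ Y))) i) X
          (Pi.single i 1) =
        ∑ j, ((defGradS χ X).adjugate i j * fderiv ℝ (fun Y => a (χ Y) j) X (Pi.single i 1) +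
          a (χ X) j * fderiv ℝ (fun Y => (defGradS χ Y).adjugate i j) X (Pi.single i 1)) := by
    have heq : (fun Y => (defGradS χ Y).det * ((defGradS χ Y)⁻¹.mulVec (a (χ Y))) i) =ᶠ[nhds X]
        fun Y => ∑ j, (defGradS χ Y).adjugate i j * a (χ Y) j :=
      Filter.eventually_of_mem (hU.mem_nhds hX) fun Y hY =>
        det_mul_inv_mulVec_apply (hdet Y hY) _ i
    rw [heq.fderiv_eq, (HasFDerivAt.fun_sum fun j _ =>
      (hadj i j).hasFDerivAt.fun_mul (haχ j).hasFDerivAt).fderiv]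
    simp
  have hmul (m j : Fin 3) :
      ∑ i, defGradS χ X m i * (defGradS χ X).adjugate i j =
        if m = j then (defGradS χ X).det else 0 := by
    rw [← mul_apply, mul_adjugate, Matrix.smul_apply, one_apply, smul_eq_mul, mul_boole]
  calc
    _ = ∑ j, (∑ m, fderiv ℝ (fun y => a y j) (χ X) (Pi.single m 1) *
            ∑ i, defGradS χ X m i * (defGradS χ X).adjugate i j) +
          ∑ j, a (χ X) j *
            ∑ i, fderiv ℝ (fun Y => (defGradS χ Y).adjugate i j) X (Pi.single i 1) := by
      simp only [hprod, fderiv_comp_apply_single hχX (haX _), Fin.sum_univ_three]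
      ring
    _ = _ := by
      simp [hmul, sum_fderiv_adjugate_eq_zero hF
        (fun i => fderiv_defGradS_apply_comm (hχi i)), Finset.mul_sum, mul_comm]
end
end

section
/- Let χ_s be a motion with deformation gradient F, Jacobian J := det F, and spatial velocity v_s; let v_f be a C¹ spatial vector field, and let c be a C¹ spatial scalar field satisfying the spatial molar balance ∂ₜc + div(c v_f) = 0 on the trajectory. Define the referential concentration c_R(X,t) := J(X,t)·c(χ_s(X,t),t) and the perfusion velocity w(X,t) := F(X,t)⁻¹ ( v_f(χ_s(X,t),t) − v_s(χ_s(X,t),t) ). Then the referential molar balance ∂ₜc_R + Div(c_R w) = 0 holds on U × ℝ, where Div is the divergence with respect to X. -/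
section SliceDerivatives

variable {E F : Type*} [NormedAddCommGroup E] [NormedSpace ℝ E]
  [NormedAddCommGroup F] [NormedSpace ℝ F]

theorem fderiv_slice_left {f : E × ℝ → F} {x : E} {t : ℝ}
    (hf : DifferentiableAt ℝ f (x, t)) (v : E) :
    fderiv ℝ (fun y => f (y, t)) x v = fderiv ℝ f (x, t) (v, 0) := by
  have h : HasFDerivAt (fun y => f (y, t)) _ x :=
    hf.hasFDerivAt.comp x (hasFDerivAt_prodMk_left x t)
  rw [h.fderiv]
  simp

theorem deriv_slice_right {f : E × ℝ → F} {x : E} {t : ℝ}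
    (hf : DifferentiableAt ℝ f (x, t)) :
    deriv (fun s => f (x, s)) t = fderiv ℝ f (x, t) (0, 1) := by
  have h : HasFDerivAt (fun s => f (x, s)) _ t :=
    hf.hasFDerivAt.comp t (hasFDerivAt_prodMk_right x t)
  rw [← fderiv_apply_one_eq_deriv, h.fderiv]
  simp

end SliceDerivatives

theorem fderiv_pi_real_prod_apply {f : (Fin 3 → ℝ) × ℝ → ℝ} {p : (Fin 3 → ℝ) × ℝ}
    (u : (Fin 3 → ℝ) × ℝ) :
    fderiv ℝ f p u
      = ∑ k, u.1 k * fderiv ℝ f p (Pi.single k 1, 0) + u.2 * fderiv ℝ f p (0, 1) := by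
  have hu : u = ∑ k, u.1 k • ((Pi.single k 1, 0) : (Fin 3 → ℝ) × ℝ) + u.2 • ((0, 1) : (Fin 3 → ℝ) × ℝ) := by
    ext k
    · fin_cases k <;> simp [Fin.sum_univ_three]
    · simp [Fin.sum_univ_three]
  conv_lhs => rw [hu]
  simp only [map_add, map_sum, map_smul, smul_eq_mul]

/-- The divergence of a density times the cofactor matrix of a curl-free matrix field applied to
a velocity field, together with the rate of change of the determinant (Piola and Jacobi). -/
theorem fderiv_det_mul_add_sum_fderiv_adjugate_mulVec
    {P : Type*} [NormedAddCommGroup P] [NormedSpace ℝ P] {p : P}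
    {g : P → Matrix (Fin 3) (Fin 3) ℝ} {c : P → ℝ} {v w : P → Fin 3 → ℝ}
    (e : Fin 3 → P) (τ : P)
    (hg : ∀ i j, DifferentiableAt ℝ (fun q => g q i j) p)
    (hc : DifferentiableAt ℝ c p)
    (hv : ∀ i, DifferentiableAt ℝ (fun q => v q i) p)
    (hw : ∀ i, DifferentiableAt ℝ (fun q => w q i) p)
    (hcurl : ∀ i j k, fderiv ℝ (fun q => g q i j) p (e k) = fderiv ℝ (fun q => g q i k) p (e j))
    (htime : ∀ i j, fderiv ℝ (fun q => g q i j) p τ = fderiv ℝ (fun q => w q i) p (e j)) :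
    fderiv ℝ (fun q => (g q).det * c q) p τ
      + ∑ i, fderiv ℝ (fun q => c q * ((g q).adjugate.mulVec (v q - w q)) i) p (e i)
    = (g p).det * fderiv ℝ c p τ
      + ∑ i, ∑ j, (g p).adjugate i j *
        (fderiv ℝ c p (e i) * (v p j - w p j) + c p * fderiv ℝ (fun q => v q j) p (e i)) := by
  have hcurl' : ∀ i,
      fderiv ℝ (fun q => g q i 1) p (e 0) = fderiv ℝ (fun q => g q i 0) p (e 1) ∧
      fderiv ℝ (fun q => g q i 2) p (e 0) = fderiv ℝ (fun q => g q i 0) p (e 2) ∧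
      fderiv ℝ (fun q => g q i 2) p (e 1) = fderiv ℝ (fun q => g q i 1) p (e 2) :=
    fun i => ⟨hcurl i 1 0, hcurl i 2 0, hcurl i 2 1⟩
  simp only [Matrix.det_fin_three, Matrix.adjugate_fin_three, Matrix.mulVec, dotProduct,
    Fin.sum_univ_three, Pi.sub_apply, Matrix.of_apply, Matrix.cons_val', Matrix.cons_val_zero,
    Matrix.cons_val_one, Matrix.cons_val, Matrix.cons_val_fin_one]
  simp (disch := fun_prop) only [fderiv_fun_mul, fderiv_fun_add, fderiv_fun_sub, fderiv_fun_neg,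
    _root_.add_apply, _root_.sub_apply, _root_.neg_apply,
    _root_.smul_apply, smul_eq_mul, htime, hcurl']
  ring


open Matrix

noncomputable section

/-- The referential concentration `c_R(X,t) = J(X,t) c(χ(X,t),t)`. -/
def refConc (χ : (Fin 3 → ℝ) → ℝ → (Fin 3 → ℝ)) (c : (Fin 3 → ℝ) → ℝ → ℝ)
    (X : Fin 3 → ℝ) (t : ℝ) : ℝ :=
  (defGrad χ X t).det * c (χ X t) t

/-- The perfusion velocity `w(X,t) = F(X,t)⁻¹ (v_f(χ(X,t),t) − v_s(χ(X,t),t))`. -/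
def perfVel (χ : (Fin 3 → ℝ) → ℝ → (Fin 3 → ℝ)) (vf vs : (Fin 3 → ℝ) → ℝ → (Fin 3 → ℝ))
    (X : Fin 3 → ℝ) (t : ℝ) : Fin 3 → ℝ :=
  (defGrad χ X t)⁻¹.mulVec (vf (χ X t) t - vs (χ X t) t)

/-- if the spatial molar balance `∂ₜc + div(c v_f) = 0` holds on the
trajectory, then the referential molar balance `∂ₜc_R + Div(c_R w) = 0` holds on `U × ℝ`. -/
theorem referential_molar_balance
    (U : Set (Fin 3 → ℝ)) (hU : IsOpen U)
    (χ : (Fin 3 → ℝ) → ℝ → (Fin 3 → ℝ))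
    (hχ : ContDiffOn ℝ 2 (fun p : (Fin 3 → ℝ) × ℝ => χ p.1 p.2) (U ×ˢ Set.univ))
    (hinj : ∀ t : ℝ, Set.InjOn (fun X => χ X t) U)
    (hopen : ∀ t : ℝ, IsOpen ((fun X => χ X t) '' U))
    (hF : ∀ X ∈ U, ∀ t : ℝ, (defGrad χ X t).det ≠ 0)
    (vs : (Fin 3 → ℝ) → ℝ → (Fin 3 → ℝ))
    (hveq : ∀ X ∈ U, ∀ t : ℝ, vs (χ X t) t = deriv (fun τ => χ X τ) t)
    (vf : (Fin 3 → ℝ) → ℝ → (Fin 3 → ℝ))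
    (hvf : ContDiff ℝ 1 (fun p : (Fin 3 → ℝ) × ℝ => vf p.1 p.2))
    (c : (Fin 3 → ℝ) → ℝ → ℝ)
    (hc : ContDiff ℝ 1 (fun p : (Fin 3 → ℝ) × ℝ => c p.1 p.2))
    (hbal : ∀ X ∈ U, ∀ t : ℝ,
      deriv (fun τ => c (χ X t) τ) t
        + ∑ i, fderiv ℝ (fun y => c y t * vf y t i) (χ X t) (Pi.single i 1) = 0) :
    ∀ X ∈ U, ∀ t : ℝ,
      deriv (fun τ => refConc χ c X τ) t
        + ∑ i, fderiv ℝ (fun Y => refConc χ c Y t * perfVel χ vf vs Y t i)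
            X (Pi.single i 1) = 0 := by
  intro X hX t
  set G : (Fin 3 → ℝ) × ℝ → Fin 3 → ℝ := fun p => χ p.1 p.2 with hG
  let e : Fin 3 → (Fin 3 → ℝ) × ℝ := fun i => (Pi.single i 1, 0)
  let τ : (Fin 3 → ℝ) × ℝ := (0, 1)
  have hG2 : ∀ Y ∈ U, ∀ s, ContDiffAt ℝ 2 G (Y, s) := fun Y hY s =>
    hχ.contDiffAt ((hU.prod isOpen_univ).mem_nhds ⟨hY, Set.mem_univ s⟩)
  have hGd : ∀ Y ∈ U, ∀ s, DifferentiableAt ℝ G (Y, s) := fun Y hY s =>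
    (hG2 Y hY s).differentiableAt (by norm_num)
  have hGi : ∀ Y ∈ U, ∀ s i u, fderiv ℝ (fun q => G q i) (Y, s) u = fderiv ℝ G (Y, s) u i := by
    intro Y hY s i u
    rw [fderiv_apply (hGd Y hY s)]
    rfl
  have hDG : DifferentiableAt ℝ (fderiv ℝ G) (X, t) :=
    ((hG2 X hX t).fderiv_right (m := 1) (by norm_num)).differentiableAt (by norm_num)
  have hsymm : IsSymmSndFDerivAt ℝ G (X, t) := (hG2 X hX t).isSymmSndFDerivAt (by simp)
  have hDGu : ∀ u i, HasFDerivAt (fun q => fderiv ℝ G q u i)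
      ((ContinuousLinearMap.proj (R := ℝ) (φ := fun _ : Fin 3 => ℝ) i).comp
        ((ContinuousLinearMap.apply ℝ (Fin 3 → ℝ) u).comp (fderiv ℝ (fderiv ℝ G) (X, t))))
      (X, t) := fun u i =>
    (ContinuousLinearMap.proj (R := ℝ) (φ := fun _ : Fin 3 => ℝ) i).hasFDerivAt.comp (X, t)
      ((ContinuousLinearMap.apply ℝ (Fin 3 → ℝ) u).hasFDerivAt.comp (X, t) hDG.hasFDerivAt)
  have hswap : ∀ u w i, fderiv ℝ (fun q => fderiv ℝ G q u i) (X, t) w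
      = fderiv ℝ (fun q => fderiv ℝ G q w i) (X, t) u := by
    intro u w i
    rw [(hDGu u i).fderiv, (hDGu w i).fderiv]
    exact congrFun (hsymm.eq w u) i
  let g : (Fin 3 → ℝ) × ℝ → Matrix (Fin 3) (Fin 3) ℝ :=
    fun q => Matrix.of fun i j => fderiv ℝ G q (e j) i
  let cc : (Fin 3 → ℝ) × ℝ → ℝ := fun q => c (G q) q.2
  let v : (Fin 3 → ℝ) × ℝ → Fin 3 → ℝ := fun q => vf (G q) q.2
  let w : (Fin 3 → ℝ) × ℝ → Fin 3 → ℝ := fun q => fderiv ℝ G q τ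
  have hgF : ∀ Y ∈ U, ∀ s, defGrad χ Y s = g (Y, s) := by
    intro Y hY s
    ext i j
    exact (fderiv_slice_left (f := fun q => G q i)
      (differentiableAt_pi.1 (hGd Y hY s) i) _).trans (hGi Y hY s i _)
  have hvs : ∀ Y ∈ U, ∀ s, vs (χ Y s) s = w (Y, s) := fun Y hY s =>
    (hveq Y hY s).trans (deriv_slice_right (f := G) (hGd Y hY s))
  have hconc : ∀ Y ∈ U, ∀ s, refConc χ c Y s = (g (Y, s)).det * cc (Y, s) := by
    intro Y hY s
    rw [refConc, hgF Y hY s]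
  have hflux : ∀ Y ∈ U, ∀ s i, refConc χ c Y s * perfVel χ vf vs Y s i
      = cc (Y, s) * ((g (Y, s)).adjugate.mulVec (v (Y, s) - w (Y, s))) i := by
    intro Y hY s i
    have hdet := hF Y hY s
    rw [hgF Y hY s] at hdet
    rw [hconc Y hY s, perfVel, hgF Y hY s, hvs Y hY s, Matrix.inv_def, Matrix.smul_mulVec,
      Pi.smul_apply, Ring.inverse_eq_inv', smul_eq_mul]
    change _ * ((g (Y, s)).det⁻¹ * ((g (Y, s)).adjugate.mulVec (v (Y, s) - w (Y, s))) i) = _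
    field_simp
  let H : (Fin 3 → ℝ) × ℝ → (Fin 3 → ℝ) × ℝ := fun q => (G q, q.2)
  have hH : HasFDerivAt H ((fderiv ℝ G (X, t)).prod (ContinuousLinearMap.snd ℝ _ _)) (X, t) :=
    (hGd X hX t).hasFDerivAt.prodMk hasFDerivAt_snd
  let c' : (Fin 3 → ℝ) × ℝ → ℝ := fun p => c p.1 p.2
  let v' : Fin 3 → (Fin 3 → ℝ) × ℝ → ℝ := fun i p => vf p.1 p.2 i
  have hc' : DifferentiableAt ℝ c' (G (X, t), t) := hc.differentiable (by norm_num) _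
  have hv' : ∀ i, DifferentiableAt ℝ (v' i) (G (X, t), t) := fun i =>
    differentiableAt_pi.1 (hvf.differentiable (by norm_num) (G (X, t), t)) i
  have hccH : HasFDerivAt cc _ (X, t) := HasFDerivAt.comp (X, t) (g := c') hc'.hasFDerivAt hH
  have hvH : ∀ i, HasFDerivAt (fun q => v q i) _ (X, t) := fun i =>
    HasFDerivAt.comp (X, t) (g := v' i) (hv' i).hasFDerivAt hH
  have hgd : ∀ i j, DifferentiableAt ℝ (fun q => g q i j) (X, t) := fun i j =>
    (hDGu (e j) i).differentiableAt
  have hwd : ∀ i, DifferentiableAt ℝ (fun q => w q i) (X, t) := fun i =>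
    (hDGu τ i).differentiableAt
  have hvd : ∀ i, DifferentiableAt ℝ (fun q => v q i) (X, t) := fun i => (hvH i).differentiableAt
  have hcd : DifferentiableAt ℝ cc (X, t) := hccH.differentiableAt
  have key := fderiv_det_mul_add_sum_fderiv_adjugate_mulVec e τ hgd hcd hvd hwd
    (fun i j k => hswap (e j) (e k) i) (fun i j => hswap (e j) τ i)
  have hdetd : DifferentiableAt ℝ (fun q => (g q).det * cc q) (X, t) := by
    simp only [Matrix.det_fin_three]
    fun_prop
  have hfluxd : ∀ i, DifferentiableAt ℝ
      (fun q => cc q * ((g q).adjugate.mulVec (v q - w q)) i) (X, t) := by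
    intro i
    simp only [Matrix.adjugate_fin_three, Matrix.mulVec, dotProduct, Fin.sum_univ_three,
      Pi.sub_apply]
    fin_cases i <;> simp <;> fun_prop
  have hleft : deriv (fun s => refConc χ c X s) t
      = fderiv ℝ (fun q => (g q).det * cc q) (X, t) τ := by
    rw [funext (hconc X hX)]
    exact deriv_slice_right (f := fun q => (g q).det * cc q) hdetd
  have hright : ∀ i, fderiv ℝ (fun Y => refConc χ c Y t * perfVel χ vf vs Y t i) X
      (Pi.single i 1)
      = fderiv ℝ (fun q => cc q * ((g q).adjugate.mulVec (v q - w q)) i) (X, t) (e i) := by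
    intro i
    rw [← fderiv_slice_left (hfluxd i)]
    congr 1
    apply Filter.EventuallyEq.fderiv_eq
    filter_upwards [hU.mem_nhds hX] with Y hY using hflux Y hY t i
  rw [hleft, Finset.sum_congr rfl fun i _ => hright i, key]
  have hb := hbal X hX t
  have hb1 : deriv (fun s => c (χ X t) s) t = fderiv ℝ c' (G (X, t), t) τ :=
    deriv_slice_right (f := c') hc'
  have hb2 : ∀ i, fderiv ℝ (fun y => c y t * vf y t i) (χ X t) (Pi.single i 1)
      = c' (G (X, t), t) * fderiv ℝ (v' i) (G (X, t), t) (e i)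
        + v' i (G (X, t), t) * fderiv ℝ c' (G (X, t), t) (e i) := by
    intro i
    refine (fderiv_slice_left (f := fun q => c' q * v' i q) (hc'.mul (hv' i)) _).trans ?_
    rw [fderiv_fun_mul hc' (hv' i)]
    rfl
  rw [hb1, Finset.sum_congr rfl fun i _ => hb2 i] at hb
  have hcc : ∀ u, fderiv ℝ cc (X, t) u
      = ∑ k, fderiv ℝ G (X, t) u k * fderiv ℝ c' (G (X, t), t) (e k)
        + u.2 * fderiv ℝ c' (G (X, t), t) τ := by
    intro u
    rw [hccH.fderiv]
    exact fderiv_pi_real_prod_apply _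
  have hvv : ∀ i u, fderiv ℝ (fun q => v q i) (X, t) u
      = ∑ k, fderiv ℝ G (X, t) u k * fderiv ℝ (v' i) (G (X, t), t) (e k)
        + u.2 * fderiv ℝ (v' i) (G (X, t), t) τ := by
    intro i u
    rw [(hvH i).fderiv]
    exact fderiv_pi_real_prod_apply _
  have hge : ∀ j k, fderiv ℝ G (X, t) (e j) k = g (X, t) k j := fun _ _ => rfl
  have hwe : ∀ k, fderiv ℝ G (X, t) τ k = w (X, t) k := fun _ => rfl
  have he2 : ∀ j, (e j).2 = 0 := fun _ => rfl
  have hτ2 : τ.2 = 1 := rfl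
  have hcG : c' (G (X, t), t) = cc (X, t) := rfl
  have hvG : ∀ i, v' i (G (X, t), t) = v (X, t) i := fun _ => rfl
  simp only [hcc, hvv, hge, hwe, he2, hτ2]
  simp only [hcG, hvG] at hb
  clear_value g cc v w c' v' e τ
  simp only [Matrix.det_fin_three, Matrix.adjugate_fin_three, Fin.sum_univ_three,
    Matrix.of_apply, Matrix.cons_val', Matrix.cons_val_zero, Matrix.cons_val_one,
    Matrix.cons_val, Matrix.cons_val_fin_one] at hb ⊢
  linear_combination (g (X, t) 0 0 * g (X, t) 1 1 * g (X, t) 2 2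
    - g (X, t) 0 0 * g (X, t) 1 2 * g (X, t) 2 1 - g (X, t) 0 1 * g (X, t) 1 0 * g (X, t) 2 2
    + g (X, t) 0 1 * g (X, t) 1 2 * g (X, t) 2 0 + g (X, t) 0 2 * g (X, t) 1 0 * g (X, t) 2 1
    - g (X, t) 0 2 * g (X, t) 1 1 * g (X, t) 2 0) * hb
end
end
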